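/- Given an integer n ≥ 2, positive reals h and L, and reals V₊, V₋, let T be the matrix described in the context and let Y ∈ ℝ^{2n} be the vector with Y_n = −(V₊ − V₋)/(2L), Y_{n+1} = (V₊ − V₋)/(2L), and Y_k = 0 for all other k. Then there exists ζ ∈ ℝ^{2n} with T ζ = Y, and any two solutions of T ζ = Y differ by a constant vector (a real multiple of the all-ones vector). -/

import Mathlib

open Matrix

/-- The `2n × 2n` coupling matrix `T` of the generalized equivalent circuit ODE system
for a stack-electrode supercapacitor with `2n` stacks (indices here are `0`-based; the
paper's index `k` corresponds to `i = k − 1`). -/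
noncomputable def stackT (n : ℕ) (h L : ℝ) : Matrix (Fin (2 * n)) (Fin (2 * n)) ℝ :=
  Matrix.of fun i j =>
    if i.val = j.val then
      if i.val = 0 ∨ i.val = 2 * n - 1 then 1 / h
      else if i.val = n - 1 ∨ i.val = n then 1 / h + 1 / (2 * L)
      else 2 / h
    else if i.val + 1 = j.val ∨ j.val + 1 = i.val then
      if min i.val j.val = n - 1 then -(1 / (2 * L)) else -(1 / h)
    else 0

/-- The right-hand side vector `Y` of the equivalent circuit system, with
`Y_n = −(V₊ − V₋)/(2L)`, `Y_{n+1} = (V₊ − V₋)/(2L)` (paper's `1`-based indices; here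
these are the entries at `0`-based indices `n − 1` and `n`) and all other entries zero. -/
noncomputable def stackY (n : ℕ) (L Vp Vm : ℝ) : Fin (2 * n) → ℝ :=
  fun k =>
    if (k : ℕ) = n - 1 then -(Vp - Vm) / (2 * L)
    else if (k : ℕ) = n then (Vp - Vm) / (2 * L)
    else 0

/-- Conductance of the link between `k` and `k + 1`. -/
noncomputable def stackW (n : ℕ) (h L : ℝ) (k : ℕ) : ℝ :=
  if k = n - 1 then 1 / (2 * L) else 1 / h

/-- Rows of `T` in terms of fluxes. -/
theorem stackT_row (n : ℕ) (hn : 2 ≤ n) (h L : ℝ) (z : ℕ → ℝ) (i : ℕ) (hi : i < 2 * n) :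
    (stackT n h L).mulVec (fun j => z j.val) ⟨i, hi⟩ =
      (if i + 1 < 2 * n then stackW n h L i * (z i - z (i + 1)) else 0) +
      (if i = 0 then 0 else stackW n h L (i - 1) * (z i - z (i - 1))) := by
  have key : ∀ j : Fin (2 * n), stackT n h L ⟨i, hi⟩ j * z j.val =
      (fun j : ℕ =>
        (if j = i then ((if i + 1 < 2 * n then stackW n h L i else 0) +
          (if i = 0 then 0 else stackW n h L (i - 1))) * z i else 0) +
        (if j = i + 1 then - stackW n h L i * z (i + 1) else 0) +
        (if j = i - 1 then (if i = 0 then 0 else - stackW n h L (i - 1) * z (i - 1)) else 0))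
      j.val := by
    rintro ⟨j, hj⟩
    simp only [stackT, Matrix.of_apply]
    by_cases h1 : i = j
    · subst h1
      have e1 : ¬ (i = i + 1) := by omega
      simp only [if_true, e1, if_false]
      have e2 : (if i = i - 1 then (if i = 0 then (0 : ℝ) else
          - stackW n h L (i - 1) * z (i - 1)) else 0) = 0 := by
        split_ifs <;> first | rfl | omega
      rw [e2, add_zero, add_zero]
      congr 1
      unfold stackW
      split_ifs <;> first | omega | contradiction | ring
    · have e1 : ¬ (j = i) := fun e => h1 e.symm
      simp only [h1, e1, if_false]
      by_cases h2 : j = i + 1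
      · subst h2
        have e2 : ¬ (i + 1 = i - 1) := by omega
        have e3 : min i (i + 1) = i := by omega
        simp only [e2, e3, if_false, if_true, true_or, stackW]
        split_ifs <;> ring
      · by_cases h3 : j + 1 = i
        · subst h3
          have e3 : min (j + 1) j = j := by omega
          have e4 : ¬ (j = j + 1 + 1) := by omega
          simp only [e3, e4, or_true, if_false, if_true, stackW, Nat.add_sub_cancel]
          split_ifs <;> first | omega | contradiction | ring
        · have e2 : ¬ (i + 1 = j ∨ j + 1 = i) := by omega
          simp only [e2, h2, if_false]
          split_ifs <;> first | omega | contradiction | ring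
  have hs : (stackT n h L).mulVec (fun j => z j.val) ⟨i, hi⟩ =
      ∑ j : Fin (2 * n), stackT n h L ⟨i, hi⟩ j * z j.val := rfl
  refine (hs.trans ((Finset.sum_congr rfl (fun j _ => key j)).trans
    (Fin.sum_univ_eq_sum_range
      (fun j : ℕ =>
        (if j = i then ((if i + 1 < 2 * n then stackW n h L i else 0) +
          (if i = 0 then 0 else stackW n h L (i - 1))) * z i else 0) +
        (if j = i + 1 then - stackW n h L i * z (i + 1) else 0) +
        (if j = i - 1 then (if i = 0 then 0 else - stackW n h L (i - 1) * z (i - 1)) else 0)) (2 * n)))).trans ?_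
  have hm : i - 1 < 2 * n := by omega
  simp only [Finset.sum_add_distrib, Finset.sum_ite_eq', Finset.mem_range, hi, hm, if_true]
  split_ifs <;> ring

/-- The equilibrium system `T ζ = Y` is solvable, and any two solutions differ by a
constant vector (a real multiple of the all-ones vector). -/
theorem stackT_equilibrium_exists_unique_up_to_constant (n : ℕ) (hn : 2 ≤ n)
    (h L : ℝ) (hh : 0 < h) (hL : 0 < L) (Vp Vm : ℝ) :
    (∃ ζ : Fin (2 * n) → ℝ, (stackT n h L).mulVec ζ = stackY n L Vp Vm) ∧
    ∀ ζ₁ ζ₂ : Fin (2 * n) → ℝ,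
      (stackT n h L).mulVec ζ₁ = stackY n L Vp Vm →
      (stackT n h L).mulVec ζ₂ = stackY n L Vp Vm →
      ∃ c : ℝ, ∀ i, ζ₁ i - ζ₂ i = c := by
  constructor
  · refine ⟨fun j => (fun k : ℕ => if k < n then 0 else Vp - Vm) j.val, ?_⟩
    funext ⟨i, hi⟩
    refine (stackT_row n hn h L (fun k : ℕ => if k < n then 0 else Vp - Vm) i hi).trans ?_
    simp only [stackY, stackW]
    split_ifs <;> first | omega | contradiction | ring
  · intro a b ha hb
    let z : ℕ → ℝ := fun k => if hk : k < 2 * n then a ⟨k, hk⟩ - b ⟨k, hk⟩ else 0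
    have hz : (fun j : Fin (2 * n) => z j.val) = a - b := by
      funext j
      simp [z]
    have h0 : ∀ i, i < 2 * n → (if i + 1 < 2 * n then stackW n h L i * (z i - z (i + 1)) else 0) +
      (if i = 0 then 0 else stackW n h L (i - 1) * (z i - z (i - 1))) = 0 := by
      intro i hi
      rw [← stackT_row n hn h L z i hi, hz, Matrix.mulVec_sub, ha, hb]
      simp
    have hw : ∀ k, stackW n h L k ≠ 0 := by
      intro k
      unfold stackW
      split_ifs <;> positivity
    have step : ∀ k, k + 1 < 2 * n → z k = z (k + 1) := by
      intro k
      induction k with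
      | zero =>
        intro hk
        have := h0 0 (by omega)
        simp only [hk, if_true, add_zero, mul_eq_zero, hw, false_or] at this
        linarith
      | succ k ih =>
        intro hk
        have e := h0 (k + 1) (by omega)
        have := ih (by omega)
        simp only [hk, if_true, Nat.add_sub_cancel, this, sub_self, mul_zero, ite_self, add_zero,
          mul_eq_zero, hw, false_or] at e
        linarith
    have hc : ∀ k, k < 2 * n → z k = z 0 := by
      intro k
      induction k with
      | zero => intro _; rfl
      | succ k ih => intro hk; rw [← step k hk]; exact ih (by omega)
    refine ⟨z 0, fun i => ?_⟩
    rw [← hc i.val i.isLt]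
    exact (congrFun hz i).symm
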